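/- Let k ≥ 4 and n ≥ 2k + 2 be integers. Then the distance spectral radius of the graph G* = K₁ ∨ (K_{n-k-1} ∪ kK₁) satisfies λ₁(D(G*)) > n + k − 1. -/

import Mathlib

/-- The disjoint union `G ∪ H` of two simple graphs (on the sum of the vertex types). -/
def graphDisjUnion {α β : Type*} (G : SimpleGraph α) (H : SimpleGraph β) :
    SimpleGraph (α ⊕ β) :=
  SimpleGraph.fromRel (Sum.LiftRel G.Adj H.Adj)

/-- The join `G ∨ H` of two simple graphs: the disjoint union together with all edges
between the two parts. -/
def graphJoin {α β : Type*} (G : SimpleGraph α) (H : SimpleGraph β) :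
    SimpleGraph (α ⊕ β) :=
  SimpleGraph.fromRel (fun u v => Sum.LiftRel G.Adj H.Adj u v ∨ (u.isLeft ∧ v.isRight))

/-- The distance matrix of a graph: the `(u,v)` entry is the graph distance `d_G(u,v)`. -/
noncomputable def distMatrix {V : Type*} [Fintype V] (G : SimpleGraph V) :
    Matrix V V ℝ :=
  Matrix.of fun u v => (G.dist u v : ℝ)

/-- The distance spectral radius `λ₁(D(G))`: the largest eigenvalue of the distance
matrix of `G` (for a connected graph the distance matrix is symmetric nonnegative, so this
is the largest element of its real spectrum). -/
noncomputable def distSpecRad {V : Type*} [Fintype V] [DecidableEq V]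
    (G : SimpleGraph V) : ℝ :=
  sSup (spectrum ℝ (distMatrix G))

/-- `G` has a spanning `k`-tree: a spanning subgraph which is a tree of maximum degree
at most `k`. -/
def HasSpanningKTree {V : Type*} [Fintype V] (G : SimpleGraph V) (k : ℕ) : Prop :=
  ∃ T : SimpleGraph V, T ≤ G ∧ T.IsTree ∧ ∀ v : V, (T.neighborSet v).ncard ≤ k

/-- The Wiener index `W(G) = ∑_{i<j} d_G(v_i, v_j)`, written as half of the full double
sum of distances. -/
noncomputable def wiener {V : Type*} [Fintype V] (G : SimpleGraph V) : ℝ :=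
  (∑ u : V, ∑ v : V, (G.dist u v : ℝ)) / 2

/-- The graph `G* = K₁ ∨ (K_{n-k-1} ∪ kK₁)`. -/
def starGraph (n k : ℕ) : SimpleGraph (Fin 1 ⊕ (Fin (n - k - 1) ⊕ Fin k)) :=
  graphJoin (⊤ : SimpleGraph (Fin 1))
    (graphDisjUnion (⊤ : SimpleGraph (Fin (n - k - 1))) (⊥ : SimpleGraph (Fin k)))

/-- The graph `G♯ = K_{(n-3)/3} ∨ ((2n+3)/3)K₁`. -/
def sharpGraph (n : ℕ) : SimpleGraph (Fin ((n - 3) / 3) ⊕ Fin ((2 * n + 3) / 3)) :=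
  graphJoin (⊤ : SimpleGraph (Fin ((n - 3) / 3))) (⊥ : SimpleGraph (Fin ((2 * n + 3) / 3)))

/-- The graph `G̃ = K_s ∨ (K_{n-(k-1)s-2} ∪ ((k-2)s+2)K₁)`. -/
def tildeGraph (n k s : ℕ) :
    SimpleGraph (Fin s ⊕ (Fin (n - (k - 1) * s - 2) ⊕ Fin ((k - 2) * s + 2))) :=
  graphJoin (⊤ : SimpleGraph (Fin s))
    (graphDisjUnion (⊤ : SimpleGraph (Fin (n - (k - 1) * s - 2)))
      (⊥ : SimpleGraph (Fin ((k - 2) * s + 2))))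

/-- The graph `G' = K_s ∨ (K_{n-s-(t-1)} ∪ (t-1)K₁)`. -/
def primeGraph (n s t : ℕ) :
    SimpleGraph (Fin s ⊕ (Fin (n - s - (t - 1)) ⊕ Fin (t - 1))) :=
  graphJoin (⊤ : SimpleGraph (Fin s))
    (graphDisjUnion (⊤ : SimpleGraph (Fin (n - s - (t - 1)))) (⊥ : SimpleGraph (Fin (t - 1))))

lemma SimpleGraph.dist_eq_two_of_common_neighbor {V : Type*} {G : SimpleGraph V} {u v w : V}
    (huv : u ≠ v) (hnadj : ¬ G.Adj u v) (huw : G.Adj u w) (hwv : G.Adj w v) :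
    G.dist u v = 2 := by
  have hle : G.dist u v ≤ 2 := SimpleGraph.dist_le (.cons huw (.cons hwv .nil))
  have hpos : 0 < G.dist u v := (huw.reachable.trans hwv.reachable).pos_dist_of_ne huv
  have hone : G.dist u v ≠ 1 := fun h => hnadj (SimpleGraph.dist_eq_one_iff_adj.mp h)
  omega

lemma le_distSpecRad_of_mulVec_eq {V : Type*} [Fintype V] [DecidableEq V]
    (G : SimpleGraph V) {x : V → ℝ} {r : ℝ} (hx : x ≠ 0)
    (h : (distMatrix G).mulVec x = r • x) : r ≤ distSpecRad G := by
  refine le_csSup (Matrix.finite_real_spectrum).bddAbove ?_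
  rw [← Matrix.spectrum_toLin']
  refine Module.End.HasEigenvalue.mem_spectrum
    (Module.End.hasEigenvalue_of_hasEigenvector (x := x) ?_)
  exact ⟨Module.End.mem_eigenspace_iff.mpr (by simpa using h), hx⟩

section Distances

variable {n k : ℕ}

lemma starGraph_adj_hub (v : Fin (n - k - 1) ⊕ Fin k) (i : Fin 1) :
    (starGraph n k).Adj (.inl i) (.inr v) := by
  simp [starGraph, graphJoin]

lemma starGraph_adj_clique {i j : Fin (n - k - 1)} (h : i ≠ j) :
    (starGraph n k).Adj (.inr (.inl i)) (.inr (.inl j)) := by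
  simp [starGraph, graphJoin, graphDisjUnion, h]

lemma starGraph_not_adj_clique_pendant (i : Fin (n - k - 1)) (j : Fin k) :
    ¬ (starGraph n k).Adj (.inr (.inl i)) (.inr (.inr j)) := by
  simp [starGraph, graphJoin, graphDisjUnion]

lemma starGraph_not_adj_pendant (i j : Fin k) :
    ¬ (starGraph n k).Adj (.inr (.inr i)) (.inr (.inr j)) := by
  simp [starGraph, graphJoin, graphDisjUnion]

lemma starGraph_dist_hub (v : Fin (n - k - 1) ⊕ Fin k) (i : Fin 1) :
    (starGraph n k).dist (.inl i) (.inr v) = 1 :=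
  SimpleGraph.dist_eq_one_iff_adj.mpr (starGraph_adj_hub v i)

lemma starGraph_dist_clique (i j : Fin (n - k - 1)) :
    (starGraph n k).dist (.inr (.inl i)) (.inr (.inl j)) = if i = j then 0 else 1 := by
  split_ifs with h
  · simp [h]
  · exact SimpleGraph.dist_eq_one_iff_adj.mpr (starGraph_adj_clique h)

lemma starGraph_dist_clique_pendant (i : Fin (n - k - 1)) (j : Fin k) :
    (starGraph n k).dist (.inr (.inl i)) (.inr (.inr j)) = 2 :=
  SimpleGraph.dist_eq_two_of_common_neighbor (by simp)
    (starGraph_not_adj_clique_pendant i j) (starGraph_adj_hub _ 0).symm (starGraph_adj_hub _ 0)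

lemma starGraph_dist_pendant (i j : Fin k) :
    (starGraph n k).dist (.inr (.inr i)) (.inr (.inr j)) = if i = j then 0 else 2 := by
  split_ifs with h
  · simp [h]
  · exact SimpleGraph.dist_eq_two_of_common_neighbor (by simp [h])
      (starGraph_not_adj_pendant i j) (starGraph_adj_hub _ 0).symm (starGraph_adj_hub _ 0)

end Distances

lemma Fin.sum_ite_eq_zero_else (m : ℕ) (i : Fin m) (c : ℝ) :
    ∑ j : Fin m, (if i = j then 0 else c) = (m - 1) * c := by
  have h : ∀ j : Fin m, (if i = j then 0 else c) = c - if i = j then c else 0 := by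
    intro j; split_ifs <;> simp
  simp only [h, Finset.sum_sub_distrib, Finset.sum_ite_eq, Finset.mem_univ, if_true]
  simp
  ring

/-- A vector constant on the hub, the clique and the pendant vertices is an eigenvector of the
distance matrix as soon as its three values solve the quotient eigenvalue equations. -/
lemma starGraph_distMatrix_mulVec {n k : ℕ} {m a b c r : ℝ} (hm : ((n - k - 1 : ℕ) : ℝ) = m)
    (hhub : m * b + k * c = r * a) (hclique : a + (m - 1) * b + 2 * k * c = r * b)
    (hpendant : a + 2 * m * b + 2 * (k - 1) * c = r * c) :
    (distMatrix (starGraph n k)).mulVec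
        (Sum.elim (fun _ => a) (Sum.elim (fun _ => b) (fun _ => c))) =
      r • Sum.elim (fun _ => a) (Sum.elim (fun _ => b) (fun _ => c)) := by
  funext v
  rcases v with i | i | i
  · have hi : ∀ j : Fin 1, (starGraph n k).dist (.inl i) (.inl j) = 0 := by
      intro j; simp [Subsingleton.elim i j]
    simp [Matrix.mulVec, dotProduct, distMatrix, starGraph_dist_hub, hi, hm, ← hhub]
  · simp only [Matrix.mulVec, dotProduct, distMatrix, Matrix.of_apply, Fintype.sum_sum_type,
      Sum.elim_inl, Sum.elim_inr, SimpleGraph.dist_comm (v := Sum.inl _), starGraph_dist_hub,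
      starGraph_dist_clique, starGraph_dist_clique_pendant, ← Finset.sum_mul,
      Nat.cast_ite, Nat.cast_zero, Nat.cast_one, Fin.sum_ite_eq_zero_else, Pi.smul_apply,
      smul_eq_mul, ← hclique, hm]
    simp
    ring
  · simp only [Matrix.mulVec, dotProduct, distMatrix, Matrix.of_apply, Fintype.sum_sum_type,
      Sum.elim_inl, Sum.elim_inr, SimpleGraph.dist_comm (v := Sum.inl _),
      SimpleGraph.dist_comm (u := Sum.inr (Sum.inr _)) (v := Sum.inr (Sum.inl _)),
      starGraph_dist_hub,
      starGraph_dist_pendant, starGraph_dist_clique_pendant, ← Finset.sum_mul,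
      Nat.cast_ite, Nat.cast_zero, Nat.cast_ofNat, Fin.sum_ite_eq_zero_else, Pi.smul_apply,
      smul_eq_mul, ← hpendant]
    simp [hm]
    ring

/-- The characteristic polynomial of the quotient distance matrix of `K₁ ∨ (K_m ∪ kK₁)` has a
root exceeding `m + 2k`. -/
lemma exists_quotient_root {m k : ℝ} (hk : 4 ≤ k) (hm : k + 1 ≤ m) :
    ∃ r, m + 2 * k < r ∧
      r * ((r - m + 1) * (r + 2) - 2 * k * (r + m + 1)) - m * (r + 2) - k * (r + m + 1) = 0 := by
  set g : ℝ → ℝ := fun r =>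
    r * ((r - m + 1) * (r + 2) - 2 * k * (r + m + 1)) - m * (r + 2) - k * (r + m + 1) with hg
  have hlow : g (m + 2 * k) < 0 := by
    have h : (2 * k + 1) * (m + 2 * k + 2) - 2 * k * (2 * m + 2 * k + 1) < 0 := by nlinarith
    have h' := mul_neg_of_pos_of_neg (show 0 < m + 2 * k by linarith) h
    simp only [hg]
    nlinarith [mul_pos (show 0 < m by linarith) (show 0 < k by linarith)]
  have hhigh : 0 < g (4 * (m + k)) := by
    obtain ⟨j, rfl⟩ : ∃ j, k = 4 + j := ⟨k - 4, by ring⟩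
    obtain ⟨t, rfl⟩ : ∃ t, m = 4 + j + 1 + t := ⟨m - (4 + j + 1), by ring⟩
    have hj : 0 ≤ j := by linarith
    have ht : 0 ≤ t := by linarith
    simp only [hg]
    ring_nf
    positivity
  have hcont : Continuous g := by fun_prop
  obtain ⟨r, hr, hr0⟩ := intermediate_value_Ioo (show m + 2 * k ≤ 4 * (m + k) by linarith)
    hcont.continuousOn ⟨hlow, hhigh⟩
  exact ⟨r, hr.1, hr0⟩

/-- For `k ≥ 4` and `n ≥ 2k + 2`, the distance spectral radius of
`G* = K₁ ∨ (K_{n-k-1} ∪ kK₁)` satisfies `λ₁(D(G*)) > n + k - 1`. -/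
theorem distSpecRad_starGraph_gt (k n : ℕ) (hk : 4 ≤ k) (hn : 2 * k + 2 ≤ n) :
    (n : ℝ) + (k : ℝ) - 1 < distSpecRad (starGraph n k) := by
  have hk' : (4 : ℝ) ≤ k := by exact_mod_cast hk
  have hn' : 2 * (k : ℝ) + 2 ≤ n := by exact_mod_cast hn
  have hm : ((n - k - 1 : ℕ) : ℝ) = n - k - 1 := by
    rw [Nat.cast_sub (by omega), Nat.cast_sub (by omega), Nat.cast_one]
  obtain ⟨r, hlt, hroot⟩ :=
    exists_quotient_root (m := (n : ℝ) - k - 1) hk' (by linarith)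
  refine lt_of_lt_of_le (by linarith) (le_distSpecRad_of_mulVec_eq _ ?_
    (starGraph_distMatrix_mulVec (r := r) (b := r + 2) (c := r + (n - k - 1) + 1)
      (a := (r - (n - k - 1) + 1) * (r + 2) - 2 * k * (r + (n - k - 1) + 1))
      hm (by linarith) (by ring) (by ring)))
  intro h
  have h0 := congrFun h (.inr (.inr ⟨0, by omega⟩))
  simp only [Sum.elim_inr, Pi.zero_apply] at h0
  linarith
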